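/- Let u : ℝ² × ℝ → ℝ and q₁, q₂ : ℝ² × ℝ → ℝ be smooth functions, 2π-periodic in each of the two spatial variables, satisfying ∂ₜu = Δu + ∂₁(u·q₁) + ∂₂(u·q₂) and ∂ₜqᵢ = u·∂ᵢu for i = 1, 2. Then for every t ∈ ℝ the function t ↦ (1/2)∫_{[0,2π]²} (|∇u|² + (∂₁q₁ + ∂₂q₂)²) dx has derivative at t equal to −∫_{[0,2π]²} (Δu)² dx − ∫_{[0,2π]²} (∂₁u·q₁ + ∂₂u·q₂)·Δu dx + ∫_{[0,2π]²} |∇u|²·(∂₁q₁ + ∂₂q₂) dx, where |∇u|² = (∂₁u)² + (∂₂u)² and Δ = ∂₁₁ + ∂₂₂ acts in the spatial variables. -/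

import Mathlib

open Real

/-- Partial derivative in the first spatial variable of a function on ℝ² × ℝ. -/
noncomputable def pd1 (f : (ℝ × ℝ) × ℝ → ℝ) (p : (ℝ × ℝ) × ℝ) : ℝ :=
  deriv (fun z => f ((z, p.1.2), p.2)) p.1.1

/-- Partial derivative in the second spatial variable of a function on ℝ² × ℝ. -/
noncomputable def pd2 (f : (ℝ × ℝ) × ℝ → ℝ) (p : (ℝ × ℝ) × ℝ) : ℝ :=
  deriv (fun z => f ((p.1.1, z), p.2)) p.1.2

/-- Partial derivative in the time variable of a function on ℝ² × ℝ. -/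
noncomputable def pdt (f : (ℝ × ℝ) × ℝ → ℝ) (p : (ℝ × ℝ) × ℝ) : ℝ :=
  deriv (fun s => f (p.1, s)) p.2

/-- Spatial Laplacian Δ = ∂₁₁ + ∂₂₂ of a function on ℝ² × ℝ. -/
noncomputable def lap (f : (ℝ × ℝ) × ℝ → ℝ) (p : (ℝ × ℝ) × ℝ) : ℝ :=
  pd1 (pd1 f) p + pd2 (pd2 f) p

open MeasureTheory intervalIntegral

abbrev EE := (ℝ × ℝ) × ℝ

lemma pd1_eq {f : EE → ℝ} (hf : ContDiff ℝ (⊤ : ℕ∞) f) :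
    pd1 f = fun p => fderiv ℝ f p ((1, 0), 0) := by
  funext p
  have h1 : HasDerivAt (fun z : ℝ => (((z, p.1.2), p.2) : EE)) ((1, 0), 0) p.1.1 :=
    ((hasDerivAt_id _).prodMk (hasDerivAt_const _ _)).prodMk (hasDerivAt_const _ _)
  have h2 : HasFDerivAt f (fderiv ℝ f p) (((p.1.1, p.1.2), p.2) : EE) :=
    (hf.differentiable (by simp) p).hasFDerivAt
  exact (h2.comp_hasDerivAt p.1.1 h1).deriv

lemma pd2_eq {f : EE → ℝ} (hf : ContDiff ℝ (⊤ : ℕ∞) f) :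
    pd2 f = fun p => fderiv ℝ f p ((0, 1), 0) := by
  funext p
  have h1 : HasDerivAt (fun z : ℝ => (((p.1.1, z), p.2) : EE)) ((0, 1), 0) p.1.2 :=
    ((hasDerivAt_const _ _).prodMk (hasDerivAt_id _)).prodMk (hasDerivAt_const _ _)
  have h2 : HasFDerivAt f (fderiv ℝ f p) (((p.1.1, p.1.2), p.2) : EE) :=
    (hf.differentiable (by simp) p).hasFDerivAt
  exact (h2.comp_hasDerivAt p.1.2 h1).deriv

lemma pdt_eq {f : EE → ℝ} (hf : ContDiff ℝ (⊤ : ℕ∞) f) :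
    pdt f = fun p => fderiv ℝ f p ((0, 0), 1) := by
  funext p
  have h1 : HasDerivAt (fun z : ℝ => ((p.1, z) : EE)) ((0, 0), 1) p.2 :=
    (hasDerivAt_const _ _).prodMk (hasDerivAt_id _)
  have h2 : HasFDerivAt f (fderiv ℝ f p) ((p.1, p.2) : EE) :=
    (hf.differentiable (by simp) p).hasFDerivAt
  exact (h2.comp_hasDerivAt p.2 h1).deriv

lemma smooth_dir {f : EE → ℝ} (hf : ContDiff ℝ (⊤ : ℕ∞) f) (v : EE) :
    ContDiff ℝ (⊤ : ℕ∞) (fun p => fderiv ℝ f p v) :=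
  (hf.fderiv_right (m := (⊤ : ℕ∞)) (by simp)).clm_apply contDiff_const

lemma smooth_pd1 {f : EE → ℝ} (hf : ContDiff ℝ (⊤ : ℕ∞) f) : ContDiff ℝ (⊤ : ℕ∞) (pd1 f) := by
  rw [pd1_eq hf]; exact smooth_dir hf _

lemma smooth_pd2 {f : EE → ℝ} (hf : ContDiff ℝ (⊤ : ℕ∞) f) : ContDiff ℝ (⊤ : ℕ∞) (pd2 f) := by
  rw [pd2_eq hf]; exact smooth_dir hf _

lemma smooth_pdt {f : EE → ℝ} (hf : ContDiff ℝ (⊤ : ℕ∞) f) : ContDiff ℝ (⊤ : ℕ∞) (pdt f) := by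
  rw [pdt_eq hf]; exact smooth_dir hf _

lemma dir_comm {f : EE → ℝ} (hf : ContDiff ℝ (⊤ : ℕ∞) f) (v w : EE) (p : EE) :
    fderiv ℝ (fun r => fderiv ℝ f r v) p w = fderiv ℝ (fun r => fderiv ℝ f r w) p v := by
  have hd : DifferentiableAt ℝ (fderiv ℝ f) p :=
    (hf.fderiv_right (m := (⊤ : ℕ∞)) (by simp)).differentiable (by simp) p
  have hs : IsSymmSndFDerivAt ℝ f p :=
    hf.contDiffAt.isSymmSndFDerivAt (by
      rw [minSmoothness_of_isRCLikeNormedField]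
      exact WithTop.coe_le_coe.2 (le_top : (2 : ℕ∞) ≤ ⊤))
  have key : ∀ a b : EE, fderiv ℝ (fun r => fderiv ℝ f r a) p b = fderiv ℝ (fderiv ℝ f) p b a := by
    intro a b
    have := (hd.hasFDerivAt.clm_apply (hasFDerivAt_const a p)).fderiv
    rw [this]; simp
  rw [key, key]
  exact hs w v

lemma pdt_pd1 {f : EE → ℝ} (hf : ContDiff ℝ (⊤ : ℕ∞) f) : pdt (pd1 f) = pd1 (pdt f) := by
  rw [pdt_eq (smooth_pd1 hf), pd1_eq (smooth_pdt hf), pd1_eq hf, pdt_eq hf]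
  funext p; exact dir_comm hf _ _ p

lemma pdt_pd2 {f : EE → ℝ} (hf : ContDiff ℝ (⊤ : ℕ∞) f) : pdt (pd2 f) = pd2 (pdt f) := by
  rw [pdt_eq (smooth_pd2 hf), pd2_eq (smooth_pdt hf), pd2_eq hf, pdt_eq hf]
  funext p; exact dir_comm hf _ _ p

lemma dir_mul {f g : EE → ℝ} (hf : ContDiff ℝ (⊤ : ℕ∞) f) (hg : ContDiff ℝ (⊤ : ℕ∞) g) (p v : EE) :
    fderiv ℝ (fun r => f r * g r) p v = fderiv ℝ f p v * g p + f p * fderiv ℝ g p v := by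
  rw [fderiv_fun_mul (hf.differentiable (by simp) p) (hg.differentiable (by simp) p)]
  simp; ring

lemma pd1_mul {f g : EE → ℝ} (hf : ContDiff ℝ (⊤ : ℕ∞) f) (hg : ContDiff ℝ (⊤ : ℕ∞) g) (p : EE) :
    pd1 (fun r => f r * g r) p = pd1 f p * g p + f p * pd1 g p := by
  rw [pd1_eq hf, pd1_eq hg, pd1_eq (hf.mul hg)]; exact dir_mul hf hg p _

lemma pd2_mul {f g : EE → ℝ} (hf : ContDiff ℝ (⊤ : ℕ∞) f) (hg : ContDiff ℝ (⊤ : ℕ∞) g) (p : EE) :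
    pd2 (fun r => f r * g r) p = pd2 f p * g p + f p * pd2 g p := by
  rw [pd2_eq hf, pd2_eq hg, pd2_eq (hf.mul hg)]; exact dir_mul hf hg p _

lemma hasDerivAt_t {f : EE → ℝ} (hf : ContDiff ℝ (⊤ : ℕ∞) f) (x y s : ℝ) :
    HasDerivAt (fun s => f ((x, y), s)) (pdt f ((x, y), s)) s := by
  have : Differentiable ℝ (fun s => f ((x, y), s)) :=
    (hf.differentiable (by simp)).comp (by fun_prop)
  exact (this s).hasDerivAt

lemma hasDerivAt_1 {f : EE → ℝ} (hf : ContDiff ℝ (⊤ : ℕ∞) f) (x y s : ℝ) :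
    HasDerivAt (fun x => f ((x, y), s)) (pd1 f ((x, y), s)) x := by
  have : Differentiable ℝ (fun x => f ((x, y), s)) :=
    (hf.differentiable (by simp)).comp (by fun_prop)
  exact (this x).hasDerivAt

lemma hasDerivAt_2 {f : EE → ℝ} (hf : ContDiff ℝ (⊤ : ℕ∞) f) (x y s : ℝ) :
    HasDerivAt (fun y => f ((x, y), s)) (pd2 f ((x, y), s)) y := by
  have : Differentiable ℝ (fun y => f ((x, y), s)) :=
    (hf.differentiable (by simp)).comp (by fun_prop)
  exact (this y).hasDerivAt

lemma swap_cont {F : ℝ → ℝ → ℝ} (hF : Continuous (Function.uncurry F)) (a b c d : ℝ) :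
    ∫ x in a..b, ∫ y in c..d, F x y = ∫ y in c..d, ∫ x in a..b, F x y := by
  apply intervalIntegral_intervalIntegral_swap
  have h : IntegrableOn (Function.uncurry F) (Set.uIcc a b ×ˢ Set.uIcc c d) :=
    hF.continuousOn.integrableOn_compact (isCompact_uIcc.prod isCompact_uIcc)
  have h2 := h.mono_set (Set.prod_mono Set.uIoc_subset_uIcc Set.uIoc_subset_uIcc)
  exact h2

lemma int_pd2 {f : EE → ℝ} (hf : ContDiff ℝ (⊤ : ℕ∞) f)
    (hp : ∀ x y t : ℝ, f ((x, y + 2 * π), t) = f ((x, y), t)) (t : ℝ) :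
    ∫ x in (0:ℝ)..(2 * π), ∫ y in (0:ℝ)..(2 * π), pd2 f ((x, y), t) = 0 := by
  have hc := (smooth_pd2 hf).continuous
  have : ∀ x : ℝ, ∫ y in (0:ℝ)..(2 * π), pd2 f ((x, y), t) = 0 := by
    intro x
    rw [integral_eq_sub_of_hasDerivAt (fun y _ => hasDerivAt_2 hf x y t)
      (Continuous.intervalIntegrable (by fun_prop) _ _)]
    have := hp x 0 t
    rw [zero_add] at this
    linarith
  simp [this]

lemma int_pd1 {f : EE → ℝ} (hf : ContDiff ℝ (⊤ : ℕ∞) f)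
    (hp : ∀ x y t : ℝ, f ((x + 2 * π, y), t) = f ((x, y), t)) (t : ℝ) :
    ∫ x in (0:ℝ)..(2 * π), ∫ y in (0:ℝ)..(2 * π), pd1 f ((x, y), t) = 0 := by
  have hc := (smooth_pd1 hf).continuous
  rw [swap_cont (F := fun x y => pd1 f ((x, y), t)) (by unfold Function.uncurry; fun_prop)]
  have : ∀ y : ℝ, ∫ x in (0:ℝ)..(2 * π), pd1 f ((x, y), t) = 0 := by
    intro y
    rw [integral_eq_sub_of_hasDerivAt (fun x _ => hasDerivAt_1 hf x y t)
      (Continuous.intervalIntegrable (by fun_prop) _ _)]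
    have := hp 0 y t
    rw [zero_add] at this
    linarith
  simp [this]

lemma cont_inner {f : EE → ℝ} (hf : Continuous f) (a b : ℝ) :
    Continuous (fun z : ℝ × ℝ => ∫ y in a..b, f ((z.1, y), z.2)) :=
  continuous_parametric_intervalIntegral_of_continuous' (by unfold Function.uncurry; fun_prop) _ _

lemma cont_outer {f : EE → ℝ} (hf : Continuous f) (a b : ℝ) :
    Continuous (fun s : ℝ => ∫ x in a..b, ∫ y in a..b, f ((x, y), s)) := by
  have := cont_inner hf a b
  exact continuous_parametric_intervalIntegral_of_continuous'
    (f := fun s x => ∫ y in a..b, f ((x, y), s))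
    (this.comp (continuous_snd.prodMk continuous_fst)) _ _

lemma ii_add {f g : EE → ℝ} (hf : Continuous f) (hg : Continuous g) (a b t : ℝ) :
    ∫ x in a..b, ∫ y in a..b, (f ((x, y), t) + g ((x, y), t))
      = (∫ x in a..b, ∫ y in a..b, f ((x, y), t)) + ∫ x in a..b, ∫ y in a..b, g ((x, y), t) := by
  have hF := cont_inner hf a b
  have hG := cont_inner hg a b
  have h1 : Continuous (fun x : ℝ => ∫ y in a..b, f ((x, y), t)) :=
    hF.comp (continuous_id.prodMk continuous_const)
  have h2 : Continuous (fun x : ℝ => ∫ y in a..b, g ((x, y), t)) :=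
    hG.comp (continuous_id.prodMk continuous_const)
  rw [← integral_add (h1.intervalIntegrable _ _) (h2.intervalIntegrable _ _)]
  congr 1; funext x
  exact integral_add (Continuous.intervalIntegrable (by fun_prop) _ _)
    (Continuous.intervalIntegrable (by fun_prop) _ _)

lemma deriv_ii {f : EE → ℝ} (hf : ContDiff ℝ (⊤ : ℕ∞) f) (a b t : ℝ) :
    HasDerivAt (fun s => ∫ x in a..b, ∫ y in a..b, f ((x, y), s))
      (∫ x in a..b, ∫ y in a..b, pdt f ((x, y), t)) t := by
  have hc := (smooth_pdt hf).continuous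
  have hfc := hf.continuous
  have key : ∀ s, ∫ x in a..b, ∫ y in a..b, f ((x, y), s)
      = (∫ x in a..b, ∫ y in a..b, f ((x, y), t))
        + ∫ r in t..s, ∫ x in a..b, ∫ y in a..b, pdt f ((x, y), r) := by
    intro s
    have e1 : ∫ r in t..s, ∫ x in a..b, ∫ y in a..b, pdt f ((x, y), r)
        = ∫ x in a..b, ∫ y in a..b, (f ((x, y), s) + (-f ((x, y), t))) := by
      rw [swap_cont (F := fun r x => ∫ y in a..b, pdt f ((x, y), r))
        ((cont_inner hc a b).comp (continuous_snd.prodMk continuous_fst))]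
      congr 1; funext x
      rw [swap_cont (F := fun r y => pdt f ((x, y), r)) (by unfold Function.uncurry; fun_prop)]
      congr 1; funext y
      rw [integral_eq_sub_of_hasDerivAt (fun r _ => hasDerivAt_t hf x y r)
        (Continuous.intervalIntegrable (by fun_prop) _ _)]
      ring
    have e2 := ii_add (f := fun p => f (p.1, s)) (g := fun p => - f (p.1, t))
      (by fun_prop) (by fun_prop) a b t
    simp only at e2
    rw [e1, e2]
    simp
  have hcont := cont_outer hc a b
  have hd := integral_hasDerivAt_right (hcont.intervalIntegrable t t)
    (hcont.stronglyMeasurableAtFilter _ _) hcont.continuousAt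
  have := hd.const_add (∫ x in a..b, ∫ y in a..b, f ((x, y), t))
  exact this.congr_of_eventuallyEq (Filter.Eventually.of_forall key)

lemma per_pd1_1 {f : EE → ℝ} (hp : ∀ x y t : ℝ, f ((x + 2 * π, y), t) = f ((x, y), t)) :
    ∀ x y t : ℝ, pd1 f ((x + 2 * π, y), t) = pd1 f ((x, y), t) := by
  intro x y t
  have : (fun z => f ((z, y), t)) = fun z => f ((z + 2 * π, y), t) := by
    funext z; exact (hp z y t).symm
  simp only [pd1]
  rw [← deriv_comp_add_const (fun z => f ((z, y), t)) (2 * π) x]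
  simp only [hp]

lemma per_pd2_2 {f : EE → ℝ} (hp : ∀ x y t : ℝ, f ((x, y + 2 * π), t) = f ((x, y), t)) :
    ∀ x y t : ℝ, pd2 f ((x, y + 2 * π), t) = pd2 f ((x, y), t) := by
  intro x y t
  simp only [pd2]
  rw [← deriv_comp_add_const (fun z => f ((x, z), t)) (2 * π) y]
  simp only [hp]

/-- The H¹-level energy identity for the 2D chemotaxis system with classical
diffusion: (1/2) d/dt ∫(|∇u|² + (∇·q)²) dx
  = −∫(Δu)² dx − ∫(∇u·q)Δu dx + ∫|∇u|²(∇·q) dx. -/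
theorem energy_identity_H1_2d
    (u q₁ q₂ : (ℝ × ℝ) × ℝ → ℝ)
    (hu : ContDiff ℝ (⊤ : ℕ∞) u) (hq₁ : ContDiff ℝ (⊤ : ℕ∞) q₁) (hq₂ : ContDiff ℝ (⊤ : ℕ∞) q₂)
    (hu_per1 : ∀ x y t : ℝ, u ((x + 2 * π, y), t) = u ((x, y), t))
    (hu_per2 : ∀ x y t : ℝ, u ((x, y + 2 * π), t) = u ((x, y), t))
    (hq₁_per1 : ∀ x y t : ℝ, q₁ ((x + 2 * π, y), t) = q₁ ((x, y), t))
    (hq₁_per2 : ∀ x y t : ℝ, q₁ ((x, y + 2 * π), t) = q₁ ((x, y), t))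
    (hq₂_per1 : ∀ x y t : ℝ, q₂ ((x + 2 * π, y), t) = q₂ ((x, y), t))
    (hq₂_per2 : ∀ x y t : ℝ, q₂ ((x, y + 2 * π), t) = q₂ ((x, y), t))
    (heq_u : ∀ p : (ℝ × ℝ) × ℝ,
      pdt u p = lap u p + pd1 (fun r => u r * q₁ r) p + pd2 (fun r => u r * q₂ r) p)
    (heq_q₁ : ∀ p : (ℝ × ℝ) × ℝ, pdt q₁ p = u p * pd1 u p)
    (heq_q₂ : ∀ p : (ℝ × ℝ) × ℝ, pdt q₂ p = u p * pd2 u p) :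
    ∀ t : ℝ,
      HasDerivAt
        (fun s => (1 / 2 : ℝ) *
          ∫ x in (0:ℝ)..(2 * π), ∫ y in (0:ℝ)..(2 * π),
            ((pd1 u ((x, y), s)) ^ 2 + (pd2 u ((x, y), s)) ^ 2
              + (pd1 q₁ ((x, y), s) + pd2 q₂ ((x, y), s)) ^ 2))
        (-(∫ x in (0:ℝ)..(2 * π), ∫ y in (0:ℝ)..(2 * π), (lap u ((x, y), t)) ^ 2)
          - (∫ x in (0:ℝ)..(2 * π), ∫ y in (0:ℝ)..(2 * π),
              (pd1 u ((x, y), t) * q₁ ((x, y), t)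
                + pd2 u ((x, y), t) * q₂ ((x, y), t)) * lap u ((x, y), t))
          + ∫ x in (0:ℝ)..(2 * π), ∫ y in (0:ℝ)..(2 * π),
              ((pd1 u ((x, y), t)) ^ 2 + (pd2 u ((x, y), t)) ^ 2)
                * (pd1 q₁ ((x, y), t) + pd2 q₂ ((x, y), t))) t := by
  intro t
  have su1 := smooth_pd1 hu
  have su2 := smooth_pd2 hu
  have sut := smooth_pdt hu
  have sq1 := smooth_pd1 hq₁
  have sq2 := smooth_pd2 hq₂
  have su11 := smooth_pd1 su1
  have su22 := smooth_pd2 su2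
  have cu := hu.continuous
  have cq₁ := hq₁.continuous
  have cq₂ := hq₂.continuous
  have cu1 := su1.continuous
  have cu2 := su2.continuous
  have cq1 := sq1.continuous
  have cq2 := sq2.continuous
  have clap : Continuous (lap u) := su11.continuous.add su22.continuous
  have sF : ContDiff ℝ (⊤ : ℕ∞) (fun p => (pd1 u p) ^ 2 + (pd2 u p) ^ 2
      + (pd1 q₁ p + pd2 q₂ p) ^ 2) := by fun_prop
  have hD := (deriv_ii sF 0 (2 * π) t).const_mul (1 / 2 : ℝ)
  refine hD.congr_deriv ?_
  have sA1 : ContDiff ℝ (⊤ : ℕ∞) (fun p => pd1 u p * pdt u p) := su1.mul sut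
  have sA2 : ContDiff ℝ (⊤ : ℕ∞) (fun p => pd2 u p * pdt u p) := su2.mul sut
  have pt : ∀ p, (1 / 2 : ℝ) * pdt (fun p => (pd1 u p) ^ 2 + (pd2 u p) ^ 2
      + (pd1 q₁ p + pd2 q₂ p) ^ 2) p
      = ((pd1 (fun p => pd1 u p * pdt u p) p + pd2 (fun p => pd2 u p * pdt u p) p)
        + (-(lap u p) ^ 2 + -((pd1 u p * q₁ p + pd2 u p * q₂ p) * lap u p)))
        + ((pd1 u p) ^ 2 + (pd2 u p) ^ 2) * (pd1 q₁ p + pd2 q₂ p) := by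
    rintro ⟨⟨x, y⟩, s⟩
    have d := (((hasDerivAt_t su1 x y s).pow 2).add ((hasDerivAt_t su2 x y s).pow 2)).add
      (((hasDerivAt_t sq1 x y s).add (hasDerivAt_t sq2 x y s)).pow 2)
    have e : pdt (fun p => (pd1 u p) ^ 2 + (pd2 u p) ^ 2
      + (pd1 q₁ p + pd2 q₂ p) ^ 2) ((x, y), s) = _ := d.deriv
    rw [e, pdt_pd1 hu, pdt_pd2 hu, pdt_pd1 hq₁, pdt_pd2 hq₂, pd1_mul su1 sut, pd2_mul su2 sut,
      funext heq_q₁, funext heq_q₂, pd1_mul hu su1, pd2_mul hu su2]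
    have h := heq_u ((x, y), s)
    rw [pd1_mul hu hq₁, pd2_mul hu hq₂] at h
    rw [h]
    simp only [lap]
    simp
    ring
  rw [← intervalIntegral.integral_const_mul]
  simp_rw [← intervalIntegral.integral_const_mul, pt]
  have cB1 := (smooth_pd1 sA1).continuous
  have cB2 := (smooth_pd2 sA2).continuous
  have sper1 : ∀ x y t : ℝ, pdt u ((x + 2 * π, y), t) = pdt u ((x, y), t) := by
    intro x y t; simp only [pdt, hu_per1]
  have sper2 : ∀ x y t : ℝ, pdt u ((x, y + 2 * π), t) = pdt u ((x, y), t) := by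
    intro x y t; simp only [pdt, hu_per2]
  rw [ii_add (f := fun p => (pd1 (fun p => pd1 u p * pdt u p) p + pd2 (fun p => pd2 u p * pdt u p) p)
        + (-(lap u p) ^ 2 + -((pd1 u p * q₁ p + pd2 u p * q₂ p) * lap u p)))
      (g := fun p => ((pd1 u p) ^ 2 + (pd2 u p) ^ 2) * (pd1 q₁ p + pd2 q₂ p))
      (by fun_prop) (by fun_prop),
    ii_add (f := fun p => (pd1 (fun p => pd1 u p * pdt u p) p + pd2 (fun p => pd2 u p * pdt u p) p))
      (g := fun p => (-(lap u p) ^ 2 + -((pd1 u p * q₁ p + pd2 u p * q₂ p) * lap u p)))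
      (by fun_prop) (by fun_prop),
    ii_add (f := pd1 (fun p => pd1 u p * pdt u p)) (g := pd2 (fun p => pd2 u p * pdt u p)) cB1 cB2,
    ii_add (f := fun p => -(lap u p) ^ 2)
      (g := fun p => -((pd1 u p * q₁ p + pd2 u p * q₂ p) * lap u p))
      (by fun_prop) (by fun_prop),
    int_pd1 sA1 (by intro x y t; simp only [per_pd1_1 hu_per1, sper1]),
    int_pd2 sA2 (by intro x y t; simp only [per_pd2_2 hu_per2, sper2])]
  simp only [intervalIntegral.integral_neg]
  ring
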